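/- Under Assumption A, let {(x_k, y_k)} and {(x̂_k, ŷ_k)} be sequences generated by Algorithm 1 and set ρ = min{(θ₁ − L_∇f)/2, (θ₂ − L_∇g)/2}. Then Σ_{k=0}^{∞} ‖(x_{k+1} − x̂_k, y_{k+1} − ŷ_k)‖² ≤ (L(x₀, y₀) − inf L)/ρ < ∞; in particular ‖x_{k+1} − x̂_k‖ → 0 and ‖y_{k+1} − ŷ_k‖ → 0 as k → ∞. -/

import Mathlib

open Filter Topology
open scoped RealInnerProductSpace

/-- The Bregman distance `D_φ(x, y) = φ(x) − φ(y) − ⟨∇φ(y), x − y⟩`. -/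
noncomputable def breg {d : ℕ} (φ : EuclideanSpace ℝ (Fin d) → ℝ)
    (x y : EuclideanSpace ℝ (Fin d)) : ℝ :=
  φ x - φ y - ⟪gradient φ y, x - y⟫

/-- The objective `L(x, y) = f(x) + Q(x, y) + g(y)`, extended-real valued. -/
noncomputable def LFun {n m : ℕ} (f : EuclideanSpace ℝ (Fin n) → ℝ)
    (g : EuclideanSpace ℝ (Fin m) → ℝ)
    (Q : EuclideanSpace ℝ (Fin n) → EuclideanSpace ℝ (Fin m) → EReal)
    (x : EuclideanSpace ℝ (Fin n)) (y : EuclideanSpace ℝ (Fin m)) : EReal :=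
  (f x : EReal) + Q x y + (g y : EReal)

/-- Assumption A of the paper. -/
structure AssumpA {n m : ℕ} (f : EuclideanSpace ℝ (Fin n) → ℝ)
    (g : EuclideanSpace ℝ (Fin m) → ℝ)
    (Q : EuclideanSpace ℝ (Fin n) → EuclideanSpace ℝ (Fin m) → EReal)
    (φ₁ : EuclideanSpace ℝ (Fin n) → ℝ) (φ₂ : EuclideanSpace ℝ (Fin m) → ℝ)
    (Lf Lg θ₁ θ₂ η₁ η₂ : ℝ) : Prop where
  hLbd : ∃ B : ℝ, ∀ x y, (B : EReal) ≤ LFun f g Q x y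
  hf : ContDiff ℝ 1 f
  hg : ContDiff ℝ 1 g
  hLf0 : 0 ≤ Lf
  hLg0 : 0 ≤ Lg
  hfLip : ∀ a b, ‖gradient f a - gradient f b‖ ≤ Lf * ‖a - b‖
  hgLip : ∀ a b, ‖gradient g a - gradient g b‖ ≤ Lg * ‖a - b‖
  hQproper : (∀ x y, Q x y ≠ ⊥) ∧ ∃ x y, Q x y ≠ ⊤
  hQlsc : LowerSemicontinuous
    (fun p : EuclideanSpace ℝ (Fin n) × EuclideanSpace ℝ (Fin m) => Q p.1 p.2)
  hφ₁diff : Differentiable ℝ φ₁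
  hφ₂diff : Differentiable ℝ φ₂
  hθ₁pos : 0 < θ₁
  hθ₂pos : 0 < θ₂
  hφ₁sc : ConvexOn ℝ Set.univ (fun u => φ₁ u - θ₁ / 2 * ‖u‖ ^ 2)
  hφ₂sc : ConvexOn ℝ Set.univ (fun u => φ₂ u - θ₂ / 2 * ‖u‖ ^ 2)
  hθ₁ : Lf < θ₁
  hθ₂ : Lg < θ₂
  hφ₁Lip : ∀ a b, ‖gradient φ₁ a - gradient φ₁ b‖ ≤ η₁ * ‖a - b‖
  hφ₂Lip : ∀ a b, ‖gradient φ₂ a - gradient φ₂ b‖ ≤ η₂ * ‖a - b‖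

/-- Algorithm 1 (TiBASAP) of the paper; `x k, y k` are the iterates and
`xh k, yh k` the (possibly extrapolated) auxiliary iterates.  The conventions
`x (-1) = x 0`, `y (-1) = y 0` are realized by truncated subtraction on `ℕ`. -/
structure Alg1 {n m : ℕ} (f : EuclideanSpace ℝ (Fin n) → ℝ)
    (g : EuclideanSpace ℝ (Fin m) → ℝ)
    (Q : EuclideanSpace ℝ (Fin n) → EuclideanSpace ℝ (Fin m) → EReal)
    (φ₁ : EuclideanSpace ℝ (Fin n) → ℝ) (φ₂ : EuclideanSpace ℝ (Fin m) → ℝ)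
    (αmax βmax : ℝ) (α β : ℕ → ℝ)
    (x xh : ℕ → EuclideanSpace ℝ (Fin n)) (y yh : ℕ → EuclideanSpace ℝ (Fin m)) :
    Prop where
  hαβmax : αmax + βmax < 1
  hα : ∀ k, α k ∈ Set.Icc (0 : ℝ) αmax
  hβ : ∀ k, β k ∈ Set.Icc (0 : ℝ) βmax
  hQ0 : Q (x 0) (y 0) ≠ ⊤
  hinit : xh 0 = x 0 ∧ yh 0 = y 0
  hxmin : ∀ k x',
    Q (x (k+1)) (yh k)
        + ((⟪gradient f (xh k), x (k+1)⟫ + breg φ₁ (x (k+1)) (xh k) : ℝ) : EReal)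
      ≤ Q x' (yh k) + ((⟪gradient f (xh k), x'⟫ + breg φ₁ x' (xh k) : ℝ) : EReal)
  hymin : ∀ k y',
    Q (x (k+1)) (y (k+1))
        + ((⟪gradient g (yh k), y (k+1)⟫ + breg φ₂ (y (k+1)) (yh k) : ℝ) : EReal)
      ≤ Q (x (k+1)) y' + ((⟪gradient g (yh k), y'⟫ + breg φ₂ y' (yh k) : ℝ) : EReal)
  hupdate : ∀ k u v,
    u = x (k+1) + α k • (x (k+1) - x k) + β k • (x k - x (k-1)) →
    v = y (k+1) + α k • (y (k+1) - y k) + β k • (y k - y (k-1)) →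
      (LFun f g Q u v ≤ LFun f g Q (x (k+1)) (y (k+1)) →
        xh (k+1) = u ∧ yh (k+1) = v) ∧
      (¬ LFun f g Q u v ≤ LFun f g Q (x (k+1)) (y (k+1)) →
        xh (k+1) = x (k+1) ∧ yh (k+1) = y (k+1))

theorem hasDerivAt_comp_line {d : ℕ} {f : EuclideanSpace ℝ (Fin d) → ℝ}
    (hf : Differentiable ℝ f) (a v : EuclideanSpace ℝ (Fin d)) (t : ℝ) :
    HasDerivAt (fun s : ℝ => f (a + s • v)) ⟪gradient f (a + t • v), v⟫ t := by
  have hline : HasDerivAt (fun s : ℝ => a + s • v) v t := by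
    simpa using ((hasDerivAt_id t).smul_const v).const_add a
  have hgrad := (hf (a + t • v)).hasGradientAt.hasFDerivAt
  simpa [Function.comp_def] using hgrad.comp_hasDerivAt t hline

/-- The descent lemma for functions with Lipschitz gradient. -/
theorem le_add_of_lipschitz_gradient {d : ℕ} {f : EuclideanSpace ℝ (Fin d) → ℝ} {K : ℝ}
    (hf : Differentiable ℝ f) (hLip : ∀ a b, ‖gradient f a - gradient f b‖ ≤ K * ‖a - b‖)
    (a b : EuclideanSpace ℝ (Fin d)) :
    f b ≤ f a + ⟪gradient f a, b - a⟫ + K / 2 * ‖b - a‖ ^ 2 := by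
  set v := b - a with hv
  let F : ℝ → ℝ := fun t => f (a + t • v) - t * ⟪gradient f a, v⟫ - t ^ 2 * (K / 2 * ‖v‖ ^ 2)
  have hF (t : ℝ) : HasDerivAt F
      (⟪gradient f (a + t • v), v⟫ - ⟪gradient f a, v⟫ - 2 * t * (K / 2 * ‖v‖ ^ 2)) t := by
    have h := ((hasDerivAt_comp_line hf a v t).sub
      ((hasDerivAt_id t).mul_const ⟪gradient f a, v⟫)).sub
      (((hasDerivAt_id t).pow 2).mul_const (K / 2 * ‖v‖ ^ 2))
    exact h.congr_deriv (by simp)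
  have hanti : AntitoneOn F (Set.Icc 0 1) := by
    refine antitoneOn_of_deriv_nonpos (convex_Icc 0 1)
      (fun t _ => (hF t).continuousAt.continuousWithinAt)
      (fun t _ => (hF t).differentiableAt.differentiableWithinAt) fun t ht => ?_
    rw [interior_Icc] at ht
    rw [(hF t).deriv, ← inner_sub_left]
    have hcs := real_inner_le_norm (gradient f (a + t • v) - gradient f a) v
    have hgrad := hLip (a + t • v) a
    rw [add_sub_cancel_left, norm_smul, Real.norm_of_nonneg ht.1.le] at hgrad
    have := mul_le_mul_of_nonneg_right hgrad (norm_nonneg v)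
    linarith
  have h := hanti (Set.left_mem_Icc.2 zero_le_one) (Set.right_mem_Icc.2 zero_le_one) zero_le_one
  simp only [F, one_smul, zero_smul, add_zero, hv, add_sub_cancel] at h
  rw [← hv] at h
  linarith

/-- Strong convexity bounds the Bregman distance from below. -/
theorem le_breg_of_strongConvex {d : ℕ} {φ : EuclideanSpace ℝ (Fin d) → ℝ} {θ : ℝ}
    (hφ : Differentiable ℝ φ)
    (hconv : ConvexOn ℝ Set.univ (fun u => φ u - θ / 2 * ‖u‖ ^ 2))
    (b a : EuclideanSpace ℝ (Fin d)) :
    θ / 2 * ‖b - a‖ ^ 2 ≤ breg φ b a := by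
  set v := b - a with hv
  have hb : b = a + v := by simp [hv]
  let G : ℝ → ℝ := fun t => φ (a + t • v) - θ / 2 * ‖a + t • v‖ ^ 2
  have hG : ConvexOn ℝ Set.univ G := by
    have h := hconv.comp_affineMap (AffineMap.lineMap a b)
    have hline (t : ℝ) : AffineMap.lineMap a b t = a + t • v := by
      rw [AffineMap.lineMap_apply_module', add_comm]
    simpa [Function.comp_def, hline, G] using h
  have hderiv : HasDerivAt G (⟪gradient φ a, v⟫ - θ * ⟪a, v⟫) 0 := by
    have hline : HasDerivAt (fun s : ℝ => a + s • v) v 0 := by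
      simpa using ((hasDerivAt_id (0 : ℝ)).smul_const v).const_add a
    have h := (hasDerivAt_comp_line hφ a v 0).sub (hline.norm_sq.const_mul (θ / 2))
    refine h.congr_deriv ?_
    simp
    ring
  have h := hG.le_slope_of_hasDerivAt (Set.mem_univ 0) (Set.mem_univ 1) zero_lt_one hderiv
  rw [slope_def_field] at h
  simp only [G, one_smul, zero_smul, add_zero, sub_zero, div_one] at h
  rw [norm_add_sq_real, ← hb] at h
  unfold breg
  rw [← hv]
  linarith

/-- One Bregman proximal-linearized step: the minimizer `b` has finite value and decreases
`q + f` by at least `(θ - K) / 2 * ‖b - a‖ ^ 2`. -/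
theorem sufficient_decrease_of_bregman_step {d : ℕ}
    {f φ : EuclideanSpace ℝ (Fin d) → ℝ} {q : EuclideanSpace ℝ (Fin d) → EReal} {K θ : ℝ}
    (hf : Differentiable ℝ f) (hLip : ∀ a b, ‖gradient f a - gradient f b‖ ≤ K * ‖a - b‖)
    (hφ : Differentiable ℝ φ)
    (hconv : ConvexOn ℝ Set.univ (fun u => φ u - θ / 2 * ‖u‖ ^ 2))
    {a b : EuclideanSpace ℝ (Fin d)} (hbot : ∀ u, q u ≠ ⊥) (htop : q a ≠ ⊤)
    (hmin : q b + ((⟪gradient f a, b⟫ + breg φ b a : ℝ) : EReal)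
      ≤ q a + ((⟪gradient f a, a⟫ + breg φ a a : ℝ) : EReal)) :
    q b ≠ ⊤ ∧
      (q b).toReal + f b + (θ - K) / 2 * ‖b - a‖ ^ 2 ≤ (q a).toReal + f a := by
  lift q a to ℝ using ⟨htop, hbot a⟩ with qa
  have hb : q b ≠ ⊤ := by
    intro h
    rw [h, EReal.top_add_coe, ← EReal.coe_add, top_le_iff] at hmin
    exact EReal.coe_ne_top _ hmin
  refine ⟨hb, ?_⟩
  lift q b to ℝ using ⟨hb, hbot b⟩ with qb
  norm_cast at hmin
  have hself : breg φ a a = 0 := by simp [breg]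
  have h1 := le_breg_of_strongConvex hφ hconv b a
  have h2 := le_add_of_lipschitz_gradient hf hLip a b
  rw [inner_sub_right] at h2
  simp only [EReal.toReal_coe]
  linarith

theorem LFun_eq_coe {n m : ℕ} {f : EuclideanSpace ℝ (Fin n) → ℝ}
    {g : EuclideanSpace ℝ (Fin m) → ℝ}
    {Q : EuclideanSpace ℝ (Fin n) → EuclideanSpace ℝ (Fin m) → EReal}
    {u : EuclideanSpace ℝ (Fin n)} {v : EuclideanSpace ℝ (Fin m)}
    (hbot : Q u v ≠ ⊥) (htop : Q u v ≠ ⊤) :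
    LFun f g Q u v = ((f u + (Q u v).toReal + g v : ℝ) : EReal) := by
  unfold LFun
  lift Q u v to ℝ using ⟨htop, hbot⟩ with r
  simp

theorem ne_top_of_LFun_ne_top {n m : ℕ} {f : EuclideanSpace ℝ (Fin n) → ℝ}
    {g : EuclideanSpace ℝ (Fin m) → ℝ}
    {Q : EuclideanSpace ℝ (Fin n) → EuclideanSpace ℝ (Fin m) → EReal}
    {u : EuclideanSpace ℝ (Fin n)} {v : EuclideanSpace ℝ (Fin m)}
    (h : LFun f g Q u v ≠ ⊤) : Q u v ≠ ⊤ := by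
  intro hQ
  simp [LFun, hQ] at h

/-- The auxiliary iterates of the algorithm never increase the objective. -/
theorem Alg1.LFun_aux_le {n m : ℕ} {f : EuclideanSpace ℝ (Fin n) → ℝ}
    {g : EuclideanSpace ℝ (Fin m) → ℝ}
    {Q : EuclideanSpace ℝ (Fin n) → EuclideanSpace ℝ (Fin m) → EReal}
    {φ₁ : EuclideanSpace ℝ (Fin n) → ℝ} {φ₂ : EuclideanSpace ℝ (Fin m) → ℝ}
    {αmax βmax : ℝ} {α β : ℕ → ℝ}
    {x xh : ℕ → EuclideanSpace ℝ (Fin n)} {y yh : ℕ → EuclideanSpace ℝ (Fin m)}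
    (halg : Alg1 f g Q φ₁ φ₂ αmax βmax α β x xh y yh) (k : ℕ) :
    LFun f g Q (xh (k + 1)) (yh (k + 1)) ≤ LFun f g Q (x (k + 1)) (y (k + 1)) := by
  obtain ⟨haccept, hreject⟩ := halg.hupdate k _ _ rfl rfl
  by_cases h : LFun f g Q (x (k+1) + α k • (x (k+1) - x k) + β k • (x k - x (k-1)))
      (y (k+1) + α k • (y (k+1) - y k) + β k • (y k - y (k-1)))
        ≤ LFun f g Q (x (k+1)) (y (k+1))
  · obtain ⟨hx, hy⟩ := haccept h
    rwa [hx, hy]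
  · obtain ⟨hx, hy⟩ := hreject h
    rw [hx, hy]

/-- Sufficient decrease of the objective along the auxiliary iterates. -/
theorem Alg1.sufficient_decrease {n m : ℕ} {f : EuclideanSpace ℝ (Fin n) → ℝ}
    {g : EuclideanSpace ℝ (Fin m) → ℝ}
    {Q : EuclideanSpace ℝ (Fin n) → EuclideanSpace ℝ (Fin m) → EReal}
    {φ₁ : EuclideanSpace ℝ (Fin n) → ℝ} {φ₂ : EuclideanSpace ℝ (Fin m) → ℝ}
    {Lf Lg θ₁ θ₂ η₁ η₂ αmax βmax : ℝ} {α β : ℕ → ℝ}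
    {x xh : ℕ → EuclideanSpace ℝ (Fin n)} {y yh : ℕ → EuclideanSpace ℝ (Fin m)}
    (hA : AssumpA f g Q φ₁ φ₂ Lf Lg θ₁ θ₂ η₁ η₂)
    (halg : Alg1 f g Q φ₁ φ₂ αmax βmax α β x xh y yh) {k : ℕ}
    (hk : Q (xh k) (yh k) ≠ ⊤) :
    Q (xh (k + 1)) (yh (k + 1)) ≠ ⊤ ∧
      (LFun f g Q (xh (k + 1)) (yh (k + 1))).toReal
          + min ((θ₁ - Lf) / 2) ((θ₂ - Lg) / 2)
            * (‖x (k + 1) - xh k‖ ^ 2 + ‖y (k + 1) - yh k‖ ^ 2)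
        ≤ (LFun f g Q (xh k) (yh k)).toReal := by
  have hbot := hA.hQproper.1
  obtain ⟨htop₁, hdec₁⟩ := sufficient_decrease_of_bregman_step
    (q := fun u => Q u (yh k)) (hA.hf.differentiable one_ne_zero) hA.hfLip hA.hφ₁diff
    hA.hφ₁sc (fun u => hbot u _) hk (halg.hxmin k (xh k))
  obtain ⟨htop₂, hdec₂⟩ := sufficient_decrease_of_bregman_step
    (q := fun v => Q (x (k + 1)) v) (hA.hg.differentiable one_ne_zero) hA.hgLip hA.hφ₂diff
    hA.hφ₂sc (fun v => hbot _ v) htop₁ (halg.hymin k (yh k))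
  have hle := halg.LFun_aux_le k
  have hLtop : LFun f g Q (x (k + 1)) (y (k + 1)) ≠ ⊤ := by
    rw [LFun_eq_coe (hbot _ _) htop₂]
    exact EReal.coe_ne_top _
  have htop : Q (xh (k + 1)) (yh (k + 1)) ≠ ⊤ :=
    ne_top_of_LFun_ne_top (ne_top_of_le_ne_top hLtop hle)
  refine ⟨htop, ?_⟩
  rw [LFun_eq_coe (hbot _ _) htop, LFun_eq_coe (hbot _ _) htop₂, EReal.coe_le_coe_iff] at hle
  rw [LFun_eq_coe (hbot _ _) htop, LFun_eq_coe (hbot _ _) hk, EReal.toReal_coe,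
    EReal.toReal_coe]
  have h₁ := mul_le_mul_of_nonneg_right (min_le_left ((θ₁ - Lf) / 2) ((θ₂ - Lg) / 2))
    (sq_nonneg ‖x (k + 1) - xh k‖)
  have h₂ := mul_le_mul_of_nonneg_right (min_le_right ((θ₁ - Lf) / 2) ((θ₂ - Lg) / 2))
    (sq_nonneg ‖y (k + 1) - yh k‖)
  linarith

/-- square summability of the residuals of Algorithm 1 together
with the bound `Σ ‖(x_{k+1}−x̂_k, y_{k+1}−ŷ_k)‖² ≤ (L(x₀,y₀) − inf L)/ρ`, and
the convergence of the residuals to `0`. -/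
theorem alg1_residual_summable {n m : ℕ}
    (f : EuclideanSpace ℝ (Fin n) → ℝ) (g : EuclideanSpace ℝ (Fin m) → ℝ)
    (Q : EuclideanSpace ℝ (Fin n) → EuclideanSpace ℝ (Fin m) → EReal)
    (φ₁ : EuclideanSpace ℝ (Fin n) → ℝ) (φ₂ : EuclideanSpace ℝ (Fin m) → ℝ)
    (Lf Lg θ₁ θ₂ η₁ η₂ αmax βmax : ℝ) (α β : ℕ → ℝ)
    (x xh : ℕ → EuclideanSpace ℝ (Fin n)) (y yh : ℕ → EuclideanSpace ℝ (Fin m))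
    (hA : AssumpA f g Q φ₁ φ₂ Lf Lg θ₁ θ₂ η₁ η₂)
    (halg : Alg1 f g Q φ₁ φ₂ αmax βmax α β x xh y yh) :
    Summable (fun k => ‖x (k+1) - xh k‖ ^ 2 + ‖y (k+1) - yh k‖ ^ 2) ∧
    (∑' k, (‖x (k+1) - xh k‖ ^ 2 + ‖y (k+1) - yh k‖ ^ 2))
      ≤ ((LFun f g Q (x 0) (y 0)).toReal
          - (⨅ p : EuclideanSpace ℝ (Fin n) × EuclideanSpace ℝ (Fin m),
              LFun f g Q p.1 p.2).toReal)
        / min ((θ₁ - Lf) / 2) ((θ₂ - Lg) / 2) ∧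
    Tendsto (fun k => ‖x (k+1) - xh k‖) atTop (𝓝 0) ∧
    Tendsto (fun k => ‖y (k+1) - yh k‖) atTop (𝓝 0) := by
  set r : ℕ → ℝ := fun k => ‖x (k+1) - xh k‖ ^ 2 + ‖y (k+1) - yh k‖ ^ 2
  set ρ := min ((θ₁ - Lf) / 2) ((θ₂ - Lg) / 2)
  set I := ⨅ p : EuclideanSpace ℝ (Fin n) × EuclideanSpace ℝ (Fin m), LFun f g Q p.1 p.2
  have hρ : 0 < ρ := lt_min (by linarith [hA.hθ₁]) (by linarith [hA.hθ₂])
  have hbot := hA.hQproper.1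
  have htop (k : ℕ) : Q (xh k) (yh k) ≠ ⊤ := by
    induction k with
    | zero => rw [halg.hinit.1, halg.hinit.2]; exact halg.hQ0
    | succ k ih => exact (halg.sufficient_decrease hA ih).1
  have hIbot : I ≠ ⊥ := by
    obtain ⟨B, hB⟩ := hA.hLbd
    exact ne_bot_of_le_ne_bot (EReal.coe_ne_bot B) (le_iInf fun p => hB p.1 p.2)
  have hIle (k : ℕ) : I.toReal ≤ (LFun f g Q (xh k) (yh k)).toReal := by
    refine EReal.toReal_le_toReal (iInf_le _ (xh k, yh k)) hIbot ?_
    rw [LFun_eq_coe (hbot _ _) (htop k)]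
    exact EReal.coe_ne_top _
  have hsum (N : ℕ) : (LFun f g Q (xh N) (yh N)).toReal + ρ * ∑ k ∈ Finset.range N, r k
      ≤ (LFun f g Q (x 0) (y 0)).toReal := by
    induction N with
    | zero => simp [halg.hinit.1, halg.hinit.2]
    | succ N ih =>
      rw [Finset.sum_range_succ, mul_add]
      linarith [(halg.sufficient_decrease hA (htop N)).2]
  have hbound (N : ℕ) : ∑ k ∈ Finset.range N, r k
      ≤ ((LFun f g Q (x 0) (y 0)).toReal - I.toReal) / ρ := by
    rw [le_div_iff₀ hρ]
    linarith [hsum N, hIle N]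
  have hr0 (k : ℕ) : 0 ≤ r k := by positivity
  have hsummable : Summable r := summable_of_sum_range_le hr0 hbound
  have hlim := hsummable.tendsto_atTop_zero
  have hsqrt {s : ℕ → ℝ} (hs0 : ∀ k, 0 ≤ s k) (hs : ∀ k, s k ^ 2 ≤ r k) :
      Tendsto s atTop (𝓝 0) := by
    have h := (squeeze_zero (fun k => sq_nonneg (s k)) hs hlim).sqrt
    simpa [Real.sqrt_sq (hs0 _)] using h
  exact ⟨hsummable, Real.tsum_le_of_sum_range_le hr0 hbound,
    hsqrt (fun _ => norm_nonneg _) fun k => le_add_of_nonneg_right (sq_nonneg _),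
    hsqrt (fun _ => norm_nonneg _) fun k => le_add_of_nonneg_left (sq_nonneg _)⟩
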